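/- Suppose n = 2p is even. Let J be the n×n complex matrix J = Σ_{i=1}^{p} (e^i_{i+p} − e^{i+p}_i), where e^i_j are the matrix units. Let m = (m₁,…,m_k) be positive integers summing to n and μ ∈ ℂ[t]^k, and suppose there is a permutation τ of {1,…,k} with m_{τ(i)} = m_i and −c(μ_i) = μ_{τ(i)} − m_{τ(i)}·t + n·t for all i. Then there exists a *-structure (relative to c) on the ℂ[t]-algebra A_{m,μ,t} such that, for all 1 ≤ i,j ≤ n, ([E^i_j])* equals the (i,j) entry of the matrix −J·[E]·J^{−1}, where [E] is the n×n matrix whose (a,b) entry is the class [E^a_b] in A_{m,μ,t}. -/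

import Mathlib

noncomputable section

open Polynomial MulOpposite

abbrev Ct : Type := Polynomial ℂ

abbrev FA (n : ℕ) : Type := FreeAlgebra Ct (Fin n × Fin n)

/-- The defining relations of `U(g_t)`. -/
inductive glRel (n : ℕ) : FA n → FA n → Prop
  | comm (i j l m : Fin n) :
      glRel n
        (FreeAlgebra.ι Ct ((i, j) : Fin n × Fin n) * FreeAlgebra.ι Ct ((m, l) : Fin n × Fin n)
          - FreeAlgebra.ι Ct ((m, l) : Fin n × Fin n) * FreeAlgebra.ι Ct ((i, j) : Fin n × Fin n))
        ((X : Ct) • ((if j = m then (1 : Ct) else 0) • FreeAlgebra.ι Ct ((i, l) : Fin n × Fin n)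
          - (if i = l then (1 : Ct) else 0) • FreeAlgebra.ι Ct ((m, j) : Fin n × Fin n)))

/-- `U(g_t)`. -/
abbrev Ugt (n : ℕ) : Type := RingQuot (glRel n)

/-- The generator `E^i_j`. -/
def Egen (n : ℕ) (i j : Fin n) : Ugt n :=
  RingQuot.mkAlgHom Ct (glRel n) (FreeAlgebra.ι Ct (i, j))

/-- The matrix `E` with entries in the opposite algebra (used for the "paper" product
convention). -/
def EmatOp (n : ℕ) : Matrix (Fin n) (Fin n) (Ugt n)ᵐᵒᵖ :=
  Matrix.of fun i j => op (Egen n i j)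

/-- The matrix `E`. -/
def Emat (n : ℕ) : Matrix (Fin n) (Fin n) (Ugt n) :=
  Matrix.of fun i j => Egen n i j

/-- Entries of `(E-μ₁)⋯(E-μ_k)` in the paper's convention
`(E^ℓ)^i_j = Σ E^{α₁}_j E^{α₂}_{α₁} ⋯ E^i_{α_{ℓ-1}}`. -/
def prodE (n k : ℕ) (μ : Fin k → Ct) : Matrix (Fin n) (Fin n) (Ugt n) :=
  Matrix.of fun i j =>
    unop (((List.ofFn fun s : Fin k =>
      EmatOp n - algebraMap Ct (Matrix (Fin n) (Fin n) (Ugt n)ᵐᵒᵖ) (μ s)).prod) i j)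

/-- `Tr E^ℓ` in the paper's convention. -/
def trE (n ℓ : ℕ) : Ugt n := unop (Matrix.trace (EmatOp n ^ ℓ))

/-- Entries of `(E-ν₁)∘⋯∘(E-ν_k)` in the opposite convention
`(E^{∘ℓ})^i_j = Σ E^i_{α₁} E^{α₁}_{α₂} ⋯ E^{α_{ℓ-1}}_j`. -/
def prodEop (n k : ℕ) (ν : Fin k → Ct) : Matrix (Fin n) (Fin n) (Ugt n) :=
  (List.ofFn fun s : Fin k =>
    Emat n - algebraMap Ct (Matrix (Fin n) (Fin n) (Ugt n)) (ν s)).prod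

/-- `Tr E^{∘ℓ}`. -/
def trEop (n ℓ : ℕ) : Ugt n := Matrix.trace (Emat n ^ ℓ)

/-- `θ_ℓ(m, μ, τ)`. -/
def theta {R : Type*} [CommRing R] {k : ℕ} (m : Fin k → ℕ) (μ : Fin k → R) (τ : R)
    (ℓ : ℕ) : R :=
  ∑ s ∈ Finset.Icc 1 k,
    if s ≤ ℓ + 1 then
      τ ^ (s - 1) *
        ∑ J ∈ Finset.powersetCard s (Finset.univ : Finset (Fin k)),
          (∏ j ∈ J, (m j : R)) *
            ∑ d ∈ J.finsuppAntidiag (ℓ + 1 - s), ∏ j ∈ J, μ j ^ d j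
    else 0

/-- Generators of the two-sided ideal `I_{m,μ,t}`. -/
def genSetA (n k : ℕ) (m : Fin k → ℕ) (μ : Fin k → Ct) : Set (Ugt n) :=
  {u | ∃ i j : Fin n, u = prodE n k μ i j} ∪
  {u | ∃ ℓ ∈ Finset.Icc 1 (k - 1), u = trE n ℓ - algebraMap Ct (Ugt n) (theta m μ X ℓ)}

/-- The two-sided ideal `I_{m,μ,t}`. -/
def IdealA (n k : ℕ) (m : Fin k → ℕ) (μ : Fin k → Ct) : TwoSidedIdeal (Ugt n) :=
  TwoSidedIdeal.span (genSetA n k m μ)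

/-- The algebra `A_{m,μ,t}`, the quotient of `U(g_t)` by the two-sided ideal generated by
`genSetA`. -/
abbrev AlgA (n k : ℕ) (m : Fin k → ℕ) (μ : Fin k → Ct) : Type :=
  RingQuot (fun a b : Ugt n => a - b ∈ genSetA n k m μ)

noncomputable instance instRingRingQuotUgt (n : ℕ) (r : Ugt n → Ugt n → Prop) :
    Ring (RingQuot r) :=
  RingQuot.instRing r

/-- The class of `u ∈ U(g_t)` in `A_{m,μ,t}`. -/
def clsA (n k : ℕ) (m : Fin k → ℕ) (μ : Fin k → Ct) (u : Ugt n) : AlgA n k m μ :=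
  RingQuot.mkAlgHom Ct _ u

/-- Generators of the two-sided ideal `I°_{m,ν,t}`. -/
def genSetAop (n k : ℕ) (m : Fin k → ℕ) (ν : Fin k → Ct) : Set (Ugt n) :=
  {u | ∃ i j : Fin n, u = prodEop n k ν i j} ∪
  {u | ∃ ℓ ∈ Finset.Icc 1 (k - 1), u = trEop n ℓ - algebraMap Ct (Ugt n) (theta m ν (-X) ℓ)}

/-- The two-sided ideal `I°_{m,ν,t}`. -/
def IdealAop (n k : ℕ) (m : Fin k → ℕ) (ν : Fin k → Ct) : TwoSidedIdeal (Ugt n) :=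
  TwoSidedIdeal.span (genSetAop n k m ν)

/-- The algebra `A°_{m,ν,t}`. -/
abbrev AlgAop (n k : ℕ) (m : Fin k → ℕ) (ν : Fin k → Ct) : Type :=
  RingQuot (fun a b : Ugt n => a - b ∈ genSetAop n k m ν)

/-- The block index (as a natural number) of `a : Fin n` for block sizes `m`. -/
def blk (k : ℕ) (m : Fin k → ℕ) (a : ℕ) : ℕ :=
  (Finset.univ.filter fun i : Fin k => ∑ j ∈ Finset.Iic i, m j ≤ a).card

/-- The parabolic subalgebra `p_t`: block upper-triangular matrices. -/
def pSet (n k : ℕ) (m : Fin k → ℕ) : Set (Matrix (Fin n) (Fin n) Ct) :=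
  {x | ∀ a b : Fin n, blk k m b < blk k m a → x a b = 0}

/-- Extension of `lam : Fin k → ℂ` to `ℕ`. -/
def lamExt (k : ℕ) (lam : Fin k → ℂ) (i : ℕ) : ℂ :=
  if h : i < k then lam ⟨i, h⟩ else 0

/-- The character `λ` of `p_t`, `x ↦ Σ_i λ_i tr(x_ii)`. -/
def pChar (n k : ℕ) (m : Fin k → ℕ) (lam : Fin k → ℂ) (x : Matrix (Fin n) (Fin n) Ct) : Ct :=
  ∑ a : Fin n, C (lamExt k lam (blk k m a)) * x a a

/-- The canonical linear map `g_t → U(g_t)`. -/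
def iotaU (n : ℕ) (x : Matrix (Fin n) (Fin n) Ct) : Ugt n :=
  ∑ i : Fin n, ∑ j : Fin n, x i j • Egen n i j

/-- The left ideal `L_λ` defining the generalized Verma module. -/
def VermaIdeal (n k : ℕ) (m : Fin k → ℕ) (lam : Fin k → ℂ) : Submodule (Ugt n) (Ugt n) :=
  Submodule.span (Ugt n)
    {u | ∃ x ∈ pSet n k m, u = iotaU n x - algebraMap Ct (Ugt n) (pChar n k m lam x)}

noncomputable instance instHasQuotientUgt (n : ℕ) :
    HasQuotient (Ugt n) (Submodule (Ugt n) (Ugt n)) := by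
  with_unfolding_all exact @Submodule.hasQuotient (Ugt n) (Ugt n) _ _ Semiring.toModule

noncomputable instance instAddCommGroupQuotUgt (n : ℕ) (p : Submodule (Ugt n) (Ugt n)) :
    AddCommGroup (Ugt n ⧸ p) := by
  with_unfolding_all exact @Submodule.Quotient.addCommGroup (Ugt n) (Ugt n) _ _ Semiring.toModule p

noncomputable instance instModuleQuotUgt (n : ℕ) (p : Submodule (Ugt n) (Ugt n)) :
    Module (Ugt n) (Ugt n ⧸ p) := by
  with_unfolding_all exact @Submodule.Quotient.module (Ugt n) (Ugt n) _ _ Semiring.toModule p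

/-- The generalized Verma module `V_{p_t,λ} = U(g_t)/L_λ`. -/
abbrev Verma (n k : ℕ) (m : Fin k → ℕ) (lam : Fin k → ℂ) : Type :=
  Ugt n ⧸ VermaIdeal n k m lam

/-- The annihilator `J_{p_t,λ}` of the generalized Verma module, as a set. -/
def annSet (n k : ℕ) (m : Fin k → ℕ) (lam : Fin k → ℂ) : Set (Ugt n) :=
  {u | ∀ v : Verma n k m lam, u • v = 0}

/-- The ring involution of `ℂ[t]` conjugating the coefficients and fixing `t`. -/
def cconj : Ct → Ct := fun f => f.map (starRingEnd ℂ)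

/-- A `*`-structure on a `ℂ[t]`-algebra `B` relative to `cconj`: an additive,
`cconj`-semilinear, unital, involutive anti-automorphism. -/
def IsStarStructure {B : Type*} [Ring B] [Algebra Ct B] (s : B → B) : Prop :=
  (∀ u v : B, s (u + v) = s u + s v) ∧
  (∀ (f : Ct) (u : B), s (f • u) = cconj f • s u) ∧
  (∀ u v : B, s (u * v) = s v * s u) ∧
  s 1 = 1 ∧
  ∀ u : B, s (s u) = u

/-- The matrix `J = Σ_{i=1}^{p} (e^i_{i+p} − e^{i+p}_i)` (for `n = 2p`). -/
def Jmat (n p : ℕ) : Matrix (Fin n) (Fin n) ℂ :=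
  Matrix.of fun a b =>
    if (a : ℕ) + p = (b : ℕ) then 1 else if (b : ℕ) + p = (a : ℕ) then -1 else 0

/-- The canonical ring homomorphism `ℂ → A_{m,μ,t}`. -/
def toA (n k : ℕ) (m : Fin k → ℕ) (μ : Fin k → Ct) : ℂ →+* AlgA n k m μ :=
  (algebraMap Ct (AlgA n k m μ)).comp (Polynomial.C : ℂ →+* Ct)

theorem mul_theta_eq_coeff_prod {R : Type*} [CommRing R] {k : ℕ} (m : Fin k → ℕ) (μ : Fin k → R)
    (t : R) (ℓ : ℕ) :
    t * theta m μ t ℓ = PowerSeries.coeff (ℓ + 1)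
      (∏ j, (1 + PowerSeries.C (t * m j) * PowerSeries.X * PowerSeries.mk fun i => μ j ^ i)) := by
  classical
  rw [Finset.prod_one_add, Finset.sum_powerset, map_sum, Finset.range_eq_Ico,
    Finset.sum_eq_sum_Ico_succ_bot (by omega)]
  simp only [Finset.powersetCard_zero, Finset.sum_singleton, Finset.prod_empty,
    PowerSeries.coeff_one, theta]
  rw [if_neg (by omega), zero_add, Finset.mul_sum]
  refine Finset.sum_congr (by ext; simp) fun s hs => ?_
  have hs1 : 1 ≤ s := (Finset.mem_Ico.mp hs).1
  have key : ∀ J ∈ Finset.powersetCard s (Finset.univ : Finset (Fin k)),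
      PowerSeries.coeff (ℓ + 1) (∏ j ∈ J, (PowerSeries.C (t * m j) * PowerSeries.X *
        PowerSeries.mk fun i => μ j ^ i)) =
      if s ≤ ℓ + 1 then t ^ s * ((∏ j ∈ J, (m j : R)) *
        ∑ d ∈ J.finsuppAntidiag (ℓ + 1 - s), ∏ j ∈ J, μ j ^ d j) else 0 := by
    intro J hJ
    have hc : J.card = s := (Finset.mem_powersetCard.mp hJ).2
    have h1 : ∏ j ∈ J, (PowerSeries.C (t * m j) * PowerSeries.X *
        PowerSeries.mk fun i => μ j ^ i) =
        PowerSeries.C (t ^ s * ∏ j ∈ J, (m j : R)) * (PowerSeries.X ^ s *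
          ∏ j ∈ J, PowerSeries.mk fun i => μ j ^ i) := by
      rw [Finset.prod_mul_distrib, Finset.prod_mul_distrib, Finset.prod_const, hc, ← map_prod,
        Finset.prod_mul_distrib, Finset.prod_const, hc, mul_assoc]
    rw [h1, PowerSeries.coeff_C_mul, PowerSeries.coeff_X_pow_mul']
    split_ifs with h
    · rw [PowerSeries.coeff_prod, mul_assoc]
      simp
    · simp
  rw [map_sum, Finset.sum_congr rfl key]
  split_ifs with h
  · rw [Finset.mul_sum, Finset.mul_sum]
    refine Finset.sum_congr rfl fun J _ => ?_
    obtain ⟨r, rfl⟩ : ∃ r, s = r + 1 := ⟨s - 1, by omega⟩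
    rw [Nat.add_sub_cancel, pow_succ]
    ring
  · simp

theorem one_sub_mul_mk_pow {R : Type*} [CommRing R] (a : R) :
    (1 - PowerSeries.C a * PowerSeries.X) * (PowerSeries.mk fun i => a ^ i) = 1 := by
  ext n
  rw [sub_mul, one_mul, mul_assoc, map_sub, PowerSeries.coeff_C_mul]
  cases n with
  | zero => simp
  | succ n => simp [PowerSeries.coeff_succ_X_mul, pow_succ', PowerSeries.coeff_one]

/-- The moments `v N^ℓ 1` of a matrix `N`, for a row vector `v`. -/
def moment {R : Type*} [CommRing R] {k : ℕ} (v : Fin k → R) (N : Matrix (Fin k) (Fin k) R)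
    (ℓ : ℕ) : R :=
  v ⬝ᵥ (N ^ ℓ).mulVec 1

/-- The power series `1 + t z Σ_ℓ (v N^ℓ 1) z^ℓ`. -/
def momentSeries {R : Type*} [CommRing R] {k : ℕ} (t : R) (v : Fin k → R)
    (N : Matrix (Fin k) (Fin k) R) : PowerSeries R :=
  1 + PowerSeries.C t * PowerSeries.X * PowerSeries.mk (moment v N)

/-- The matrix `1 - z N` over power series. -/
def oneSubZMul {R : Type*} [CommRing R] {k : ℕ} (N : Matrix (Fin k) (Fin k) R) :
    Matrix (Fin k) (Fin k) (PowerSeries R) :=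
  1 - (PowerSeries.X : PowerSeries R) • N.map PowerSeries.C

theorem det_mul_momentSeries {R : Type*} [CommRing R] {k : ℕ} (t : R) (v : Fin k → R)
    (N : Matrix (Fin k) (Fin k) R) :
    (oneSubZMul N).det * momentSeries t v N =
      (oneSubZMul (N - t • Matrix.vecMulVec 1 v)).det := by
  classical
  set G : Matrix (Fin k) (Fin k) (PowerSeries R) :=
    Matrix.of fun i j => PowerSeries.mk fun ℓ => (N ^ ℓ) i j with hG
  have hinv : oneSubZMul N * G = 1 := by
    ext i j n
    rw [oneSubZMul, sub_mul, one_mul, Matrix.smul_mul, Matrix.sub_apply, Matrix.smul_apply,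
      smul_eq_mul, map_sub]
    cases n with
    | zero => by_cases h : i = j <;> simp [hG, Matrix.one_apply, h]
    | succ n =>
      rw [PowerSeries.coeff_succ_X_mul, Matrix.mul_apply, map_sum]
      simp only [hG, Matrix.of_apply, Matrix.map_apply, PowerSeries.coeff_C_mul,
        PowerSeries.coeff_mk]
      rw [← Matrix.mul_apply, ← pow_succ', sub_self]
      by_cases h : i = j <;> simp [Matrix.one_apply, h, PowerSeries.coeff_one]
  have hsum : oneSubZMul (N - t • Matrix.vecMulVec 1 v) = oneSubZMul N *
      (1 + Matrix.replicateCol Unit (G.mulVec 1) * Matrix.replicateRow Unit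
        (fun j => PowerSeries.C t * PowerSeries.X * PowerSeries.C (v j))) := by
    rw [mul_add, mul_one, Matrix.replicateCol_mulVec, ← Matrix.mul_assoc, ← Matrix.mul_assoc,
      hinv, Matrix.one_mul]
    ext1 i j
    simp [oneSubZMul, Matrix.vecMulVec, Matrix.mul_apply]
    ring
  rw [hsum, Matrix.det_mul, Matrix.det_one_add_replicateCol_mul_replicateRow]
  congr 1
  ext n
  simp only [momentSeries, hG, dotProduct, mul_assoc, map_add, ← Finset.mul_sum,
    PowerSeries.coeff_C_mul]
  cases n with
  | zero => simp
  | succ n =>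
    simp [PowerSeries.coeff_succ_X_mul, moment, dotProduct, Matrix.mulVec]

theorem theta_eq_moment {R : Type*} [CommRing R] [IsDomain R] {k : ℕ} (m : Fin k → ℕ)
    (μ : Fin k → R) {t : R} (ht : t ≠ 0) (N : Matrix (Fin k) (Fin k) R)
    (h₁ : (oneSubZMul N).det = ∏ j, (1 - PowerSeries.C (μ j) * PowerSeries.X))
    (h₂ : (oneSubZMul (N - t • Matrix.vecMulVec 1 fun j => (m j : R))).det =
      ∏ j, (1 - PowerSeries.C (μ j - t * m j) * PowerSeries.X)) (ℓ : ℕ) :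
    theta m μ t ℓ = moment (fun j => (m j : R)) N ℓ := by
  have hunit : IsUnit (∏ j, (1 - PowerSeries.C (μ j) * PowerSeries.X)) := by
    rw [IsUnit.prod_univ_iff]
    exact fun j => IsUnit.of_mul_eq_one _ (one_sub_mul_mk_pow (μ j))
  have hprod : (∏ j, (1 + PowerSeries.C (t * m j) * PowerSeries.X *
      PowerSeries.mk fun i => μ j ^ i)) = momentSeries t (fun j => (m j : R)) N := by
    refine hunit.mul_left_cancel ?_
    rw [← h₁, det_mul_momentSeries, h₁, h₂, ← Finset.prod_mul_distrib]
    refine Finset.prod_congr rfl fun j _ => ?_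
    rw [mul_add, mul_one, mul_left_comm, one_sub_mul_mk_pow, map_sub]
    ring
  refine mul_left_cancel₀ ht ?_
  rw [mul_theta_eq_coeff_prod, hprod, momentSeries, mul_assoc]
  simp [PowerSeries.coeff_one, PowerSeries.coeff_succ_X_mul]

theorem theta_comp_perm {R : Type*} [CommRing R] [IsDomain R] {k : ℕ} (m : Fin k → ℕ)
    (μ : Fin k → R) {t : R} (ht : t ≠ 0) (σ : Equiv.Perm (Fin k)) (hσ : ∀ i, m (σ i) = m i)
    (ℓ : ℕ) : theta m (μ ∘ σ) t ℓ = theta m μ t ℓ := by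
  refine mul_left_cancel₀ ht ?_
  rw [mul_theta_eq_coeff_prod, mul_theta_eq_coeff_prod]
  congr 1
  rw [← Equiv.prod_comp σ fun j => 1 + PowerSeries.C (t * m j) * PowerSeries.X *
    PowerSeries.mk fun i => μ j ^ i]
  simp [hσ]

theorem theta_neg {R : Type*} [CommRing R] {k : ℕ} (m : Fin k → ℕ) (μ : Fin k → R) (t : R)
    (ℓ : ℕ) : theta m (-μ) (-t) ℓ = (-1) ^ ℓ * theta m μ t ℓ := by
  classical
  rw [theta, theta, Finset.mul_sum]
  refine Finset.sum_congr rfl fun s hs => ?_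
  split_ifs with h
  · rw [neg_pow, Finset.mul_sum, Finset.mul_sum, Finset.mul_sum]
    refine Finset.sum_congr rfl fun J _ => ?_
    have : ∀ d ∈ J.finsuppAntidiag (ℓ + 1 - s), ∏ j ∈ J, (-μ) j ^ d j =
        (-1) ^ (ℓ + 1 - s) * ∏ j ∈ J, μ j ^ d j := by
      intro d hd
      rw [← (Finset.mem_finsuppAntidiag.mp hd).1, ← Finset.prod_pow_eq_pow_sum,
        ← Finset.prod_mul_distrib]
      exact Finset.prod_congr rfl fun j _ => neg_pow _ _
    rw [Finset.sum_congr rfl this, ← Finset.mul_sum]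
    have hℓ : (-1 : R) ^ ℓ = (-1) ^ (s - 1) * (-1) ^ (ℓ + 1 - s) := by
      rw [← pow_add]
      congr 1
      have := (Finset.mem_Icc.mp hs).1
      omega
    rw [hℓ]
    ring
  · simp

theorem map_theta {R S : Type*} [CommRing R] [CommRing S] (f : R →+* S) {k : ℕ} (m : Fin k → ℕ)
    (μ : Fin k → R) (t : R) (ℓ : ℕ) : f (theta m μ t ℓ) = theta m (f ∘ μ) (f t) ℓ := by
  simp only [theta, map_sum, apply_ite f, map_mul, map_pow, map_prod, map_natCast, map_zero,
    Function.comp_apply]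

/-- The upper triangular matrix with diagonal `μ` and entries `t m_j` above the diagonal. -/
def upperMat {R : Type*} [CommRing R] {k : ℕ} (m : Fin k → ℕ) (μ : Fin k → R) (t : R) :
    Matrix (Fin k) (Fin k) R :=
  Matrix.of fun i j => if i = j then μ i else if i < j then t * m j else 0

/-- The lower triangular matrix `upperMat m μ t - t • 1 mᵀ`. -/
def lowerMat {R : Type*} [CommRing R] {k : ℕ} (m : Fin k → ℕ) (μ : Fin k → R) (t : R) :
    Matrix (Fin k) (Fin k) R :=
  upperMat m μ t - t • Matrix.vecMulVec 1 fun j => (m j : R)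

theorem blockTriangular_upperMat {R : Type*} [CommRing R] {k : ℕ} (m : Fin k → ℕ)
    (μ : Fin k → R) (t : R) : (upperMat m μ t).BlockTriangular id := by
  intro i j h
  simp only [id] at h
  simp [upperMat, h.ne', h.le]

theorem det_oneSubZMul_upperMat {R : Type*} [CommRing R] {k : ℕ} (m : Fin k → ℕ)
    (μ : Fin k → R) (t : R) :
    (oneSubZMul (upperMat m μ t)).det = ∏ j, (1 - PowerSeries.C (μ j) * PowerSeries.X) := by
  rw [Matrix.det_of_isUpperTriangular]
  · refine Finset.prod_congr rfl fun j _ => ?_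
    simp [oneSubZMul, upperMat, mul_comm]
  · intro i j h
    have h' : j < i := h
    simp [oneSubZMul, upperMat, h'.ne', h'.not_gt]

theorem det_oneSubZMul_lowerMat {R : Type*} [CommRing R] {k : ℕ} (m : Fin k → ℕ)
    (μ : Fin k → R) (t : R) :
    (oneSubZMul (lowerMat m μ t)).det =
      ∏ j, (1 - PowerSeries.C (μ j - t * m j) * PowerSeries.X) := by
  rw [Matrix.det_of_isLowerTriangular]
  · refine Finset.prod_congr rfl fun j _ => ?_
    simp [oneSubZMul, lowerMat, upperMat, Matrix.vecMulVec, mul_comm]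
  · intro i j h
    have h' : i < j := h
    simp [oneSubZMul, lowerMat, upperMat, Matrix.vecMulVec, h'.ne, h']

theorem aeval_upperMat {R : Type*} [CommRing R] {k : ℕ} (m : Fin k → ℕ)
    (μ : Fin k → R) (t : R) :
    aeval (upperMat m μ t) (∏ j, (X - C (μ j))) = 0 := by
  have := Matrix.aeval_self_charpoly (upperMat m μ t)
  rwa [Matrix.charpoly_of_isUpperTriangular _ (blockTriangular_upperMat m μ t),
    Finset.prod_congr rfl fun j _ => show X - C (upperMat m μ t j j) = X - C (μ j) by
      simp [upperMat]] at this

/-- If the coefficients of a power series are the values of a linear map on powers of `X`, then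
multiplying by `∏ (1 - μ_j z)` yields the values on multiples of `∏ (X - μ_j)`. -/
theorem coeff_prod_one_sub_mul_mk {R ι : Type*} [CommRing R] (μ : ι → R)
    (Λ : R[X] →ₗ[R] R[X]) (S : Finset ι) (i : ℕ) :
    PowerSeries.coeff (S.card + i) ((∏ j ∈ S, (1 - PowerSeries.C (C (μ j)) * PowerSeries.X)) *
      PowerSeries.mk fun ℓ => Λ (X ^ ℓ)) = Λ ((∏ j ∈ S, (X - C (μ j))) * X ^ i) := by
  classical
  induction S using Finset.induction_on generalizing i with
  | empty => simp
  | insert a S ha ih =>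
    rw [Finset.prod_insert ha, Finset.prod_insert ha, Finset.card_insert_of_notMem ha,
      mul_assoc, sub_mul, one_mul, map_sub, mul_assoc, PowerSeries.coeff_C_mul,
      show S.card + 1 + i = S.card + i + 1 by ring, PowerSeries.coeff_succ_X_mul, ih,
      add_assoc, ih, ← smul_eq_C_mul, ← map_smul, ← map_sub]
    congr 1
    rw [smul_eq_C_mul]
    ring

/-- The polynomials with `L_0 = 1` and `L_{ℓ+1} = X L_ℓ + t φ_ℓ`. -/
def shiftPoly {R : Type*} [CommRing R] (t : R) (φ : ℕ → R) : ℕ → R[X]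
  | 0 => 1
  | ℓ + 1 => X * shiftPoly t φ ℓ + C (t * φ ℓ)

/-- The linear map with `X ^ ℓ ↦ shiftPoly t φ ℓ`. -/
def shiftMap {R : Type*} [CommRing R] (t : R) (φ : ℕ → R) : R[X] →ₗ[R] R[X] :=
  (basisMonomials R).constr R (shiftPoly t φ)

theorem shiftMap_X_pow {R : Type*} [CommRing R] (t : R) (φ : ℕ → R) (ℓ : ℕ) :
    shiftMap t φ (X ^ ℓ) = shiftPoly t φ ℓ := by
  have h : (X : R[X]) ^ ℓ = basisMonomials R ℓ := by
    simp [coe_basisMonomials, monomial_one_right_eq_X_pow]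
  rw [h, shiftMap, Module.Basis.constr_basis]

theorem mk_shiftPoly {R : Type*} [CommRing R] (t : R) (φ : ℕ → R) :
    PowerSeries.mk (shiftPoly t φ) =
      PowerSeries.map C (1 + PowerSeries.C t * PowerSeries.X * PowerSeries.mk φ) *
        PowerSeries.mk fun i => X ^ i := by
  have h : (1 - PowerSeries.C X * PowerSeries.X) * PowerSeries.mk (shiftPoly t φ) =
      PowerSeries.map C (1 + PowerSeries.C t * PowerSeries.X * PowerSeries.mk φ) := by
    ext1 n
    rw [sub_mul, one_mul, mul_assoc, map_sub, PowerSeries.coeff_C_mul, PowerSeries.coeff_map,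
      mul_assoc, map_add, PowerSeries.coeff_C_mul]
    cases n with
    | zero => simp [shiftPoly]
    | succ n => simp [shiftPoly, PowerSeries.coeff_succ_X_mul, PowerSeries.coeff_one]
  rw [← h, mul_right_comm, one_sub_mul_mk_pow, one_mul]

theorem shiftMap_prod {R : Type*} [CommRing R] {k : ℕ} (m : Fin k → ℕ) (μ : Fin k → R) (t : R) :
    shiftMap t (moment (fun j => (m j : R)) (upperMat m μ t)) (∏ j, (X - C (μ j))) =
      ∏ j, (X - C (μ j - t * m j)) := by
  have key := det_mul_momentSeries t (fun j => (m j : R)) (upperMat m μ t)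
  rw [← lowerMat, det_oneSubZMul_upperMat, det_oneSubZMul_lowerMat] at key
  replace key := congrArg (PowerSeries.map (C : R →+* R[X])) key
  simp only [map_mul, map_prod, map_sub, map_one, PowerSeries.map_C, PowerSeries.map_X] at key
  have h₁ := coeff_prod_one_sub_mul_mk μ
    (shiftMap t (moment (fun j => (m j : R)) (upperMat m μ t))) Finset.univ 0
  have h₂ := coeff_prod_one_sub_mul_mk (fun j => μ j - t * m j) LinearMap.id Finset.univ 0
  simp only [shiftMap_X_pow, pow_zero, mul_one, LinearMap.id_apply, map_mul,
    map_sub] at h₁ h₂ ⊢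
  rw [← h₁, ← h₂, ← key, mk_shiftPoly, momentSeries, ← mul_assoc]

theorem vecMul_upperMat_pow {R : Type*} [CommRing R] {k : ℕ} (m : Fin k → ℕ) (μ : Fin k → R)
    (t : R) (ℓ : ℕ) :
    Matrix.vecMul (fun j => (m j : R)) (upperMat m μ t ^ ℓ) =
      Matrix.vecMul (fun j => (m j : R)) (aeval (lowerMat m μ t)
        (shiftPoly t (moment (fun j => (m j : R)) (upperMat m μ t)) ℓ)) := by
  induction ℓ with
  | zero => simp [shiftPoly]
  | succ ℓ ih =>
    have hN : upperMat m μ t = lowerMat m μ t + t • Matrix.vecMulVec 1 fun j => (m j : R) := by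
      simp [lowerMat]
    rw [shiftPoly, mul_comm X, map_add, map_mul, aeval_X, aeval_C, Matrix.vecMul_add,
      ← Matrix.vecMul_vecMul, ← ih, pow_succ, ← Matrix.vecMul_vecMul]
    nth_rw 2 [hN]
    rw [Matrix.vecMul_add, Matrix.vecMul_smul, Matrix.vecMul_vecMulVec]
    congr 1
    rw [Algebra.algebraMap_eq_smul_one, Matrix.vecMul_smul, Matrix.vecMul_one, moment,
      Matrix.dotProduct_mulVec]
    ext
    simp [mul_assoc]

theorem span_range_shiftPoly {R : Type*} [CommRing R] (t : R) (φ : ℕ → R) :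
    Submodule.span R (Set.range (shiftPoly t φ)) = ⊤ := by
  have hX : ∀ f ∈ Submodule.span R (Set.range (shiftPoly t φ)),
      X * f ∈ Submodule.span R (Set.range (shiftPoly t φ)) := by
    intro f hf
    induction hf using Submodule.span_induction with
    | mem f hf =>
      obtain ⟨ℓ, rfl⟩ := hf
      have : X * shiftPoly t φ ℓ = shiftPoly t φ (ℓ + 1) - (t * φ ℓ) • shiftPoly t φ 0 := by
        simp [shiftPoly, smul_eq_C_mul]
      rw [this]
      exact sub_mem (Submodule.subset_span ⟨_, rfl⟩)
        (Submodule.smul_mem _ _ (Submodule.subset_span ⟨_, rfl⟩))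
    | zero => simp
    | add f g _ _ hf hg => rw [mul_add]; exact add_mem hf hg
    | smul a f _ hf => rw [mul_smul_comm]; exact Submodule.smul_mem _ _ hf
  have hpow : ∀ ℓ, (X : R[X]) ^ ℓ ∈ Submodule.span R (Set.range (shiftPoly t φ)) := by
    intro ℓ
    induction ℓ with
    | zero => exact Submodule.subset_span ⟨0, by simp [shiftPoly]⟩
    | succ ℓ ih => rw [pow_succ']; exact hX _ ih
  rw [eq_top_iff]
  rintro f -
  induction f using Polynomial.induction_on' with
  | add f g hf hg => exact add_mem hf hg
  | monomial i a =>
    rw [← C_mul_X_pow_eq_monomial, ← smul_eq_C_mul]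
    exact Submodule.smul_mem _ _ (hpow i)

section Generators

variable {R B ι : Type*} [CommRing R] [Ring B] [Algebra R B] [Fintype ι] [DecidableEq ι]

/-- The commutation relations of `U(g_t)` for a matrix over an algebra. -/
def GlComm (t : R) (e : Matrix ι ι B) : Prop :=
  ∀ i j l m, e i j * e m l - e m l * e i j =
    t • ((if j = m then e i l else 0) - (if i = l then e m j else 0))

/-- The matrix `e` over the opposite algebra. -/
def opMat (e : Matrix ι ι B) : Matrix ι ι Bᵐᵒᵖ := e.map op

/-- The value of a polynomial at `e` with products taken in the opposite algebra. -/
def opEval (e : Matrix ι ι B) : R[X] →ₗ[R] Matrix ι ι B where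
  toFun f := (aeval (opMat e) f).map unop
  map_add' f g := by ext; simp
  map_smul' a f := by ext; simp

theorem opEval_X_pow_succ_apply (e : Matrix ι ι B) (ℓ : ℕ) (i j : ι) :
    opEval e (X ^ (ℓ + 1) : R[X]) i j = ∑ a, e a j * opEval e (X ^ ℓ : R[X]) i a := by
  simp [opEval, pow_succ, Matrix.mul_apply, opMat]

theorem commutator_opEval {t : R} {e : Matrix ι ι B} (he : GlComm t e) (ℓ : ℕ) (i j l m : ι) :
    e i j * opEval e (X ^ ℓ : R[X]) m l - opEval e (X ^ ℓ : R[X]) m l * e i j =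
      t • ((if j = m then opEval e (X ^ ℓ : R[X]) i l else 0) -
        (if i = l then opEval e (X ^ ℓ : R[X]) m j else 0)) := by
  induction ℓ generalizing i j l m with
  | zero =>
    by_cases h₁ : j = m <;> by_cases h₂ : i = l <;> by_cases h₃ : m = l <;>
      by_cases h₄ : m = j <;> simp_all [opEval, Matrix.map_apply]
  | succ ℓ ih =>
    have h : ∀ a, e i j * (e a l * opEval e (X ^ ℓ : R[X]) m a) -
        e a l * opEval e (X ^ ℓ : R[X]) m a * e i j =
        t • (((if j = a then e i l * opEval e (X ^ ℓ : R[X]) m a else 0) -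
          (if i = l then e a j * opEval e (X ^ ℓ : R[X]) m a else 0)) +
        ((if j = m then e a l * opEval e (X ^ ℓ : R[X]) i a else 0) -
          (if i = a then e a l * opEval e (X ^ ℓ : R[X]) m j else 0))) := by
      intro a
      have h₁ := congrArg (· * opEval e (X ^ ℓ : R[X]) m a) (he i j l a)
      have h₂ := congrArg (e a l * ·) (ih i j a m)
      simp only [sub_mul, mul_sub, smul_mul_assoc, mul_smul_comm, ite_mul, mul_ite, zero_mul,
        mul_zero] at h₁ h₂
      rw [smul_add, ← h₁, ← h₂]
      noncomm_ring
    rw [opEval_X_pow_succ_apply, Finset.mul_sum, Finset.sum_mul, ← Finset.sum_sub_distrib,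
      Finset.sum_congr rfl fun a _ => h a, ← Finset.smul_sum]
    congr 1
    simp only [Finset.sum_add_distrib, Finset.sum_sub_distrib, Finset.sum_ite_eq,
      Finset.mem_univ, if_true, opEval_X_pow_succ_apply]
    split_ifs <;> simp
    abel

theorem opEval_X_pow_succ {t : R} {e : Matrix ι ι B} (he : GlComm t e) (ℓ : ℕ) :
    opEval e (X ^ (ℓ + 1) : R[X]) = opEval e (X ^ ℓ : R[X]) *
      (e - algebraMap R (Matrix ι ι B) (Fintype.card ι * t)) +
        t • Matrix.diagonal fun _ => (opEval e (X ^ ℓ : R[X])).trace := by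
  ext i j
  have h : ∀ a, e a j * opEval e (X ^ ℓ : R[X]) i a = opEval e (X ^ ℓ : R[X]) i a * e a j +
      t • ((if j = i then opEval e (X ^ ℓ : R[X]) a a else 0) -
        opEval e (X ^ ℓ : R[X]) i j) := by
    intro a
    have := commutator_opEval he ℓ a j a i
    rw [if_pos rfl] at this
    rw [← this]
    abel
  rw [opEval_X_pow_succ_apply, Finset.sum_congr rfl fun a _ => h a, Finset.sum_add_distrib,
    ← Finset.smul_sum, Finset.sum_sub_distrib, ← Matrix.mul_apply, mul_sub, Matrix.add_apply,
    Matrix.sub_apply, Algebra.algebraMap_eq_smul_one, mul_smul_comm, mul_one]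
  by_cases hij : i = j
  · subst hij
    simp [Matrix.trace, smul_sub, mul_smul, Nat.cast_smul_eq_nsmul]
    abel
  · simp [hij, Ne.symm hij, mul_smul, Nat.cast_smul_eq_nsmul]
    abel

theorem opEval_mul_eq_zero (e : Matrix ι ι B) {P : R[X]} (hP : opEval e P = 0) (f : R[X]) :
    opEval e (P * f) = 0 := by
  have h : aeval (opMat e) P = 0 := by
    ext i j
    exact unop_injective (congrFun (congrFun hP i) j)
  ext i j
  simp [opEval, h]

variable {k : ℕ} (m : Fin k → ℕ) (μ : Fin k → R) {t : R} {e : Matrix ι ι B}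

/-- The linear functional `f ↦ v f(N) 1` extending `moment`. -/
def momentMap (v : Fin k → R) (N : Matrix (Fin k) (Fin k) R) : R[X] →ₗ[R] R where
  toFun f := v ⬝ᵥ (aeval N f).mulVec 1
  map_add' f g := by simp [Matrix.add_mulVec]
  map_smul' a f := by simp [Matrix.smul_mulVec]

theorem momentMap_X_pow (v : Fin k → R) (N : Matrix (Fin k) (Fin k) R) (ℓ : ℕ) :
    momentMap v N (X ^ ℓ) = moment v N ℓ := by
  simp [momentMap, moment]

theorem trace_opEval_eq_momentMap [Nontrivial R] (hk : 1 ≤ k) (hm : ∑ i, m i = Fintype.card ι)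
    (hprod : opEval e (∏ j, (X - C (μ j))) = 0)
    (htr : ∀ ℓ ∈ Finset.Icc 1 (k - 1), (opEval e (X ^ ℓ : R[X])).trace =
      algebraMap R B (moment (fun j => (m j : R)) (upperMat m μ t) ℓ)) (f : R[X]) :
    (opEval e f).trace =
      algebraMap R B (momentMap (fun j => (m j : R)) (upperMat m μ t) f) := by
  set P : R[X] := ∏ j, (X - C (μ j)) with hP
  have hmonic : P.Monic := monic_prod_of_monic _ _ fun j _ => monic_X_sub_C _
  have hdeg : P.natDegree = k := by
    rw [hP, natDegree_prod_of_monic _ _ fun j _ => monic_X_sub_C _]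
    simp
  have hlow : ∀ ℓ < k, (opEval e (X ^ ℓ : R[X])).trace =
      algebraMap R B (momentMap (fun j => (m j : R)) (upperMat m μ t) (X ^ ℓ)) := by
    intro ℓ hℓ
    rw [momentMap_X_pow]
    rcases Nat.eq_zero_or_pos ℓ with rfl | hpos
    · have h1 : opEval e (X ^ 0 : R[X]) = 1 := by
        ext i j
        by_cases h : i = j <;> simp [opEval, Matrix.one_apply, h]
      rw [h1, Matrix.trace_one, ← hm]
      simp [moment, dotProduct]
    · exact htr ℓ (Finset.mem_Icc.mpr ⟨hpos, by omega⟩)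
  have hN : momentMap (fun j => (m j : R)) (upperMat m μ t) (P * (f /ₘ P)) = 0 := by
    simp [momentMap, hP, aeval_upperMat]
  rw [← modByMonic_add_div f P, map_add, map_add, opEval_mul_eq_zero e hprod, hN, add_zero,
    add_zero]
  have hr : (f %ₘ P).natDegree < k := by
    rw [← hdeg]
    refine natDegree_modByMonic_lt f hmonic fun h => ?_
    rw [h, natDegree_one] at hdeg
    omega
  rw [(f %ₘ P).as_sum_range' k hr]
  simp only [map_sum, Matrix.trace_sum]
  refine Finset.sum_congr rfl fun ℓ hℓ => ?_
  rw [← C_mul_X_pow_eq_monomial, ← smul_eq_C_mul, map_smul, map_smul, Matrix.trace_smul,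
    hlow ℓ (Finset.mem_range.mp hℓ), smul_eq_mul, map_mul, Algebra.smul_def]

theorem opEval_X_pow_eq_aeval (he : GlComm t e)
    (htr : ∀ f : R[X], (opEval e f).trace =
      algebraMap R B (momentMap (fun j => (m j : R)) (upperMat m μ t) f)) (ℓ : ℕ) :
    opEval e (X ^ ℓ : R[X]) = aeval (e - algebraMap R (Matrix ι ι B) (Fintype.card ι * t))
      (shiftPoly t (moment (fun j => (m j : R)) (upperMat m μ t)) ℓ) := by
  induction ℓ with
  | zero =>
    ext i j
    by_cases h : i = j <;> simp [opEval, shiftPoly, h]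
  | succ ℓ ih =>
    rw [opEval_X_pow_succ he, htr, ih, shiftPoly, mul_comm X, map_add (aeval _), map_mul (aeval _),
      aeval_X, aeval_C, momentMap_X_pow]
    congr 1
    ext i j
    by_cases h : i = j <;> simp [h, Matrix.algebraMap_matrix_apply, Algebra.smul_def]

theorem opEval_eq_aeval_shiftMap (he : GlComm t e)
    (htr : ∀ f : R[X], (opEval e f).trace =
      algebraMap R B (momentMap (fun j => (m j : R)) (upperMat m μ t) f)) (f : R[X]) :
    opEval e f = aeval (e - algebraMap R (Matrix ι ι B) (Fintype.card ι * t))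
      (shiftMap t (moment (fun j => (m j : R)) (upperMat m μ t)) f) := by
  induction f using Polynomial.induction_on' with
  | add f g hf hg => simp only [map_add, hf, hg]
  | monomial i a =>
    rw [← C_mul_X_pow_eq_monomial, ← smul_eq_C_mul, map_smul, map_smul, map_smul,
      opEval_X_pow_eq_aeval m μ he htr, shiftMap_X_pow]

theorem trace_aeval_sub_eq_momentMap (he : GlComm t e)
    (htr : ∀ f : R[X], (opEval e f).trace =
      algebraMap R B (momentMap (fun j => (m j : R)) (upperMat m μ t) f)) (f : R[X]) :
    (aeval (e - algebraMap R (Matrix ι ι B) (Fintype.card ι * t)) f).trace =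
      algebraMap R B (momentMap (fun j => (m j : R)) (lowerMat m μ t) f) := by
  have hf : f ∈ Submodule.span R
      (Set.range (shiftPoly t (moment (fun j => (m j : R)) (upperMat m μ t)))) := by
    rw [span_range_shiftPoly]
    trivial
  induction hf using Submodule.span_induction with
  | mem f hf =>
    obtain ⟨ℓ, rfl⟩ := hf
    rw [← opEval_X_pow_eq_aeval m μ he htr, htr]
    congr 1
    rw [momentMap, momentMap, LinearMap.coe_mk, AddHom.coe_mk, LinearMap.coe_mk, AddHom.coe_mk,
      Matrix.dotProduct_mulVec, Matrix.dotProduct_mulVec, ← vecMul_upperMat_pow, map_pow,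
      aeval_X]
  | zero => simp
  | add f g _ _ hf hg => simp only [map_add, Matrix.trace_add, hf, hg]
  | smul a f _ hf => rw [map_smul, map_smul, Matrix.trace_smul, hf, Algebra.smul_def, smul_eq_mul,
      map_mul]

theorem aeval_prod_eq_zero_and_trace_pow [IsDomain R] (ht : t ≠ 0) (hk : 1 ≤ k)
    (hm : ∑ i, m i = Fintype.card ι) (he : GlComm t e)
    (hprod : opEval e (∏ j, (X - C (μ j))) = 0)
    (htr : ∀ ℓ ∈ Finset.Icc 1 (k - 1), (opEval e (X ^ ℓ : R[X])).trace =
      algebraMap R B (theta m μ t ℓ)) (ν : Fin k → R)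
    (hν : ∀ j, ν j = μ j - m j * t + Fintype.card ι * t) :
    aeval e (∏ j, (X - C (ν j))) = 0 ∧
      ∀ ℓ, (e ^ ℓ).trace = algebraMap R B (theta m ν (-t) ℓ) := by
  set d : R := Fintype.card ι * t with hd
  have htheta : ∀ ℓ, theta m μ t ℓ = moment (fun j => (m j : R)) (upperMat m μ t) ℓ :=
    theta_eq_moment m μ ht _ (det_oneSubZMul_upperMat m μ t) (det_oneSubZMul_lowerMat m μ t)
  have htr' := trace_opEval_eq_momentMap (t := t) m μ hk hm hprod
    fun ℓ hℓ => by rw [htr ℓ hℓ, htheta]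
  have hν' : ∀ j, ν j = μ j + d - t * m j := fun j => by rw [hν]; ring
  have hcomp : ∀ f : R[X], aeval e f =
      aeval (e - algebraMap R (Matrix ι ι B) d) (f.comp (X + C d)) := fun f => by
    simp [aeval_comp]
  refine ⟨?_, fun ℓ => ?_⟩
  · have h := opEval_eq_aeval_shiftMap m μ he htr' (∏ j, (X - C (μ j)))
    rw [hprod, shiftMap_prod] at h
    rw [hcomp, h, prod_comp]
    congr 1
    refine Finset.prod_congr rfl fun j _ => ?_
    simp [hν']
    ring
  · have hlow : lowerMat m (fun j => μ j + d) t =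
        lowerMat m μ t + algebraMap R (Matrix (Fin k) (Fin k) R) d := by
      ext i j
      by_cases h : i = j <;>
        simp [lowerMat, upperMat, h, Matrix.algebraMap_matrix_apply, add_sub_right_comm]
    have h := theta_eq_moment m ν (neg_ne_zero.mpr ht) (lowerMat m (fun j => μ j + d) t)
      (by simp only [det_oneSubZMul_lowerMat, hν']) (by
        rw [show lowerMat m (fun j => μ j + d) t - (-t) • Matrix.vecMulVec 1 (fun j => (m j : R)) =
          upperMat m (fun j => μ j + d) t by simp [lowerMat], det_oneSubZMul_upperMat]
        simp [hν']) ℓ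
    have hpow := hcomp (X ^ ℓ)
    rw [map_pow, aeval_X] at hpow
    rw [hpow, trace_aeval_sub_eq_momentMap m μ he htr', h, hlow]
    simp [momentMap, moment]

end Generators

section SignedPermutation

variable {R B ι : Type*} [CommRing R] [Ring B] [Algebra R B] [Fintype ι] [DecidableEq ι]

/-- Conjugation by the signed permutation matrix with signs `ε` and permutation `σ`. -/
def signedConj (R : Type*) [CommRing R] [Algebra R B] (ε : ι → ℤ) (hε : ∀ i, ε i * ε i = 1)
    (σ : Equiv.Perm ι) : Matrix ι ι B →ₐ[R] Matrix ι ι B :=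
  AlgHom.ofLinearMap
    { toFun := fun y => Matrix.of fun i j => (ε i * ε j) • y (σ i) (σ j)
      map_add' := fun x y => by ext; simp
      map_smul' := fun a x => by ext; simp [smul_comm] }
    (by
      ext i j
      by_cases h : i = j
      · subst h
        simp [hε, -zsmul_eq_mul]
      · simp [h])
    (by
      intro x y
      ext i j
      simp only [LinearMap.coe_mk, AddHom.coe_mk, Matrix.of_apply, Matrix.mul_apply,
        Finset.smul_sum]
      rw [← Equiv.sum_comp σ]
      refine Finset.sum_congr rfl fun a _ => ?_
      rw [smul_mul_smul_comm, show ε i * ε a * (ε a * ε j) = ε a * ε a * (ε i * ε j) by ring, hε,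
        one_mul])

theorem signedConj_apply (ε : ι → ℤ) (hε : ∀ i, ε i * ε i = 1) (σ : Equiv.Perm ι)
    (y : Matrix ι ι B) (i j : ι) :
    signedConj R ε hε σ y i j = (ε i * ε j) • y (σ i) (σ j) := rfl

theorem trace_signedConj (ε : ι → ℤ) (hε : ∀ i, ε i * ε i = 1) (σ : Equiv.Perm ι)
    (y : Matrix ι ι B) : (signedConj R ε hε σ y).trace = y.trace := by
  simp only [Matrix.trace, Matrix.diag_apply, signedConj_apply, hε, one_smul]
  exact Equiv.sum_comp σ fun i => y i i

end SignedPermutation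

/-- Complex conjugation of the coefficients as a ring homomorphism. -/
def conjHom : Ct →+* Ct := Polynomial.mapRingHom (starRingEnd ℂ)

theorem conjHom_apply (f : Ct) : conjHom f = cconj f := rfl

theorem conjHom_X : conjHom X = X := by simp [conjHom]

theorem conjHom_conjHom (f : Ct) : conjHom (conjHom f) = f := by
  simp [conjHom, Polynomial.map_map]

/-- The opposite of a `ℂ[t]`-algebra, with scalars acting through `conjHom`. -/
def TwistOp (B : Type*) : Type _ := Bᵐᵒᵖ

instance (B : Type*) [Ring B] : Ring (TwistOp B) := inferInstanceAs (Ring Bᵐᵒᵖ)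

instance (B : Type*) [Ring B] [Algebra Ct B] : Algebra Ct (TwistOp B) :=
  RingHom.toAlgebra' ((algebraMap Ct Bᵐᵒᵖ).comp conjHom)
    fun f x => Algebra.commutes (A := Bᵐᵒᵖ) (conjHom f) x

/-- The element of `B` underlying an element of `TwistOp B`. -/
def TwistOp.toBase {B : Type*} (x : TwistOp B) : B := unop (α := B) x

/-- A `ℂ[t]`-algebra homomorphism to `TwistOp B` as a ring homomorphism from the opposite. -/
def oppositeHom {U B : Type*} [Semiring U] [Algebra Ct U] [Ring B] [Algebra Ct B]
    (F : U →ₐ[Ct] TwistOp B) : Uᵐᵒᵖ →+* B where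
  toFun u := (F (unop u)).toBase
  map_one' := congrArg TwistOp.toBase (map_one F)
  map_zero' := congrArg TwistOp.toBase (map_zero F)
  map_add' u v := congrArg TwistOp.toBase (map_add F (unop u) (unop v))
  map_mul' u v := congrArg TwistOp.toBase (map_mul F (unop v) (unop u))

theorem oppositeHom_algebraMap {U B : Type*} [Semiring U] [Algebra Ct U] [Ring B] [Algebra Ct B]
    (F : U →ₐ[Ct] TwistOp B) (f : Ct) :
    oppositeHom F (op (algebraMap Ct U f)) = algebraMap Ct B (cconj f) :=
  congrArg TwistOp.toBase (F.commutes f)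

theorem aeval_prod_eq_listProd {R A : Type*} [CommRing R] [Ring A] [Algebra R A] {k : ℕ} (y : A)
    (μ : Fin k → R) :
    aeval y (∏ j, (X - C (μ j))) = (List.ofFn fun j => y - algebraMap R A (μ j)).prod := by
  rw [← List.prod_ofFn, map_list_prod, List.map_ofFn]
  congr 2
  ext j
  simp

theorem oppositeHom_listProd {U B : Type*} [Ring U] [Algebra Ct U] [Ring B] [Algebra Ct B]
    {n k : ℕ} (F : U →ₐ[Ct] TwistOp B) (E : Matrix (Fin n) (Fin n) U) (μ : Fin k → Ct)
    (i j : Fin n) :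
    oppositeHom F ((List.ofFn fun s : Fin k =>
      opMat E - algebraMap Ct (Matrix (Fin n) (Fin n) Uᵐᵒᵖ) (μ s)).prod i j) =
      aeval (Matrix.of fun a b => oppositeHom F (op (E a b)))
        (∏ s, (X - C (cconj (μ s)))) i j := by
  rw [aeval_prod_eq_listProd]
  change (oppositeHom F).mapMatrix _ i j = _
  rw [map_list_prod, List.map_ofFn]
  have h : ∀ s, ((oppositeHom F).mapMatrix ∘ fun s =>
      opMat E - algebraMap Ct (Matrix (Fin n) (Fin n) Uᵐᵒᵖ) (μ s)) s =
      (Matrix.of fun a b => oppositeHom F (op (E a b))) -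
        algebraMap Ct (Matrix (Fin n) (Fin n) B) (cconj (μ s)) := by
    intro s
    ext a b
    by_cases h : a = b
    · simpa [opMat, Matrix.algebraMap_matrix_apply, h] using oppositeHom_algebraMap F (μ s)
    · simp [opMat, Matrix.algebraMap_matrix_apply, h]
  rw [funext h]

theorem oppositeHom_prodE {B : Type*} [Ring B] [Algebra Ct B] {n k : ℕ}
    (F : Ugt n →ₐ[Ct] TwistOp B) (μ : Fin k → Ct) (i j : Fin n) :
    oppositeHom F (op (prodE n k μ i j)) =
      aeval (Matrix.of fun a b => oppositeHom F (op (Egen n a b)))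
        (∏ s, (X - C (cconj (μ s)))) i j :=
  oppositeHom_listProd (U := Ugt n) F (Matrix.of fun a b => Egen n a b) μ i j

theorem oppositeHom_trE {B : Type*} [Ring B] [Algebra Ct B] {n : ℕ}
    (F : Ugt n →ₐ[Ct] TwistOp B) (ℓ : ℕ) :
    oppositeHom F (op (trE n ℓ)) =
      ((Matrix.of fun a b => oppositeHom F (op (Egen n a b))) ^ ℓ).trace := by
  have h : (Matrix.of fun a b => oppositeHom F (op (Egen n a b))) =
      (oppositeHom F).mapMatrix (EmatOp n) := rfl
  rw [h, ← map_pow, trE, op_unop]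
  simp [Matrix.trace]

theorem map_listProd {R U B : Type*} [CommRing R] [Ring U] [Algebra R U] [Ring B] [Algebra R B]
    {n k : ℕ} (π : U →ₐ[R] B) (E : Matrix (Fin n) (Fin n) U) (μ : Fin k → R) (i j : Fin n) :
    π (unop ((List.ofFn fun s : Fin k =>
      opMat E - algebraMap R (Matrix (Fin n) (Fin n) Uᵐᵒᵖ) (μ s)).prod i j)) =
      opEval (Matrix.of fun a b => π (E a b)) (∏ s, (X - C (μ s))) i j := by
  have h : opMat (Matrix.of fun a b => π (E a b)) = (AlgHom.op π).mapMatrix (opMat E) := rfl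
  rw [← aeval_prod_eq_listProd]
  change _ = unop ((aeval (opMat _) _ : Matrix _ _ Bᵐᵒᵖ) i j)
  rw [h, aeval_algHom_apply]
  rfl

theorem map_prodE {B : Type*} [Ring B] [Algebra Ct B] {n k : ℕ}
    (π : Ugt n →ₐ[Ct] B) (μ : Fin k → Ct) (i j : Fin n) :
    π (prodE n k μ i j) =
      opEval (Matrix.of fun a b => π (Egen n a b)) (∏ s, (X - C (μ s))) i j :=
  map_listProd (U := Ugt n) π (Matrix.of fun a b => Egen n a b) μ i j

theorem map_trE {B : Type*} [Ring B] [Algebra Ct B] {n : ℕ} (π : Ugt n →ₐ[Ct] B) (ℓ : ℕ) :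
    π (trE n ℓ) = (opEval (Matrix.of fun a b => π (Egen n a b)) (X ^ ℓ : Ct[X])).trace := by
  have h : opMat (Matrix.of fun a b => π (Egen n a b)) = (AlgHom.op π).mapMatrix (EmatOp n) := rfl
  have h' : opEval (Matrix.of fun a b => π (Egen n a b)) (X ^ ℓ : Ct[X]) =
      ((AlgHom.op π).mapMatrix (EmatOp n ^ ℓ)).map unop := by
    change (aeval (opMat _) _).map unop = _
    rw [h, map_pow, aeval_X, map_pow]
  rw [h']
  simp [trE, Matrix.trace]

theorem glComm_Egen (n : ℕ) : GlComm (X : Ct) (Matrix.of fun i j => Egen n i j) := by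
  intro i j l m
  have h := RingQuot.mkAlgHom_rel Ct (glRel.comm i j l m)
  simp only [map_sub, map_mul, map_smul] at h
  simpa [Egen, ite_smul] using h

theorem GlComm.map {R A B ι : Type*} [CommRing R] [Ring A] [Algebra R A] [Ring B] [Algebra R B]
    [Fintype ι] [DecidableEq ι] {t : R} {e : Matrix ι ι A} (he : GlComm t e) (π : A →ₐ[R] B) :
    GlComm t (Matrix.of fun i j => π (e i j)) := by
  intro i j l m
  have h := congrArg π (he i j l m)
  simpa [apply_ite π] using h

/-- The homomorphism `U(g_t) → TwistOp B` sending `E^i_j` to `- ε_i ε_j e^{σ i}_{σ j}`. -/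
theorem exists_twistOp_hom {B : Type*} [Ring B] [Algebra Ct B] {n : ℕ}
    {e : Matrix (Fin n) (Fin n) B} (he : GlComm (X : Ct) e) (ε : Fin n → ℤ)
    (hε : ∀ i, ε i * ε i = 1) (σ : Equiv.Perm (Fin n)) :
    ∃ F : Ugt n →ₐ[Ct] TwistOp B, ∀ i j,
      oppositeHom F (op (Egen n i j)) = -((ε i * ε j) • e (σ i) (σ j)) := by
  let y : Fin n × Fin n → B := fun q => -((ε q.1 * ε q.2) • e (σ q.1) (σ q.2))
  let F₀ : FA n →ₐ[Ct] TwistOp B := FreeAlgebra.lift Ct fun q => (op (y q) : Bᵐᵒᵖ)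
  have hF₀ : ∀ q, (F₀ (FreeAlgebra.ι Ct q)).toBase = y q := fun q =>
    congrArg TwistOp.toBase (FreeAlgebra.lift_ι_apply _ q)
  have hrel : ∀ ⦃a b⦄, glRel n a b → F₀ a = F₀ b := by
    rintro _ _ ⟨i, j, l, m⟩
    refine unop_injective (α := B) ?_
    change oppositeHom F₀ (op _) = oppositeHom F₀ (op _)
    have hι : ∀ a b, oppositeHom F₀ (op (FreeAlgebra.ι Ct (a, b))) = y (a, b) := fun a b =>
      hF₀ (a, b)
    have h := he (σ m) (σ l) (σ j) (σ i)
    rw [op_sub, op_mul, op_mul, Algebra.smul_def, op_mul, op_sub, Algebra.smul_def,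
      Algebra.smul_def, op_mul, op_mul]
    simp only [map_sub, map_mul, hι, oppositeHom_algebraMap]
    have hX : cconj X = X := conjHom_X
    have hite : ∀ (q : Prop) [Decidable q],
        algebraMap Ct B (cconj (if q then 1 else 0)) = if q then 1 else 0 := by
      intro q _
      split_ifs <;> simp [cconj]
    have hsq : ∀ i j l : Fin n, ε i * ε j * (ε j * ε l) = ε i * ε l := fun i j l => by
      rw [show ε i * ε j * (ε j * ε l) = ε j * ε j * (ε i * ε l) by ring, hε, one_mul]
    rw [hX, hite, hite, ← Algebra.commutes, ← Algebra.smul_def]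
    simp only [y, neg_mul_neg, smul_mul_smul_comm]
    rw [mul_comm (ε i * ε j), ← smul_sub, h, smul_comm, smul_sub]
    congr 1
    by_cases h₁ : j = m <;> by_cases h₂ : i = l
    · subst h₁ h₂
      simp only [hsq, hε]
      simp [-zsmul_eq_mul]
      abel
    · subst h₁
      simp [h₂, Ne.symm h₂, mul_comm (ε j * ε l), hsq, -zsmul_eq_mul]
    · subst h₂
      simp [h₁, Ne.symm h₁, hsq, -zsmul_eq_mul]
    · simp [h₁, h₂, Ne.symm h₁, Ne.symm h₂]
  refine ⟨RingQuot.liftAlgHom Ct ⟨F₀, hrel⟩, fun i j => ?_⟩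
  change (RingQuot.liftAlgHom Ct ⟨F₀, hrel⟩ (Egen n i j)).toBase = _
  rw [Egen, RingQuot.liftAlgHom_mkAlgHom_apply, hF₀]

/-- The matrix of the classes of the generators in `A_{m,μ,t}`. -/
def clsMat (n k : ℕ) (m : Fin k → ℕ) (μ : Fin k → Ct) : Matrix (Fin n) (Fin n) (AlgA n k m μ) :=
  Matrix.of fun i j => clsA n k m μ (Egen n i j)

section Quotient

variable {n k : ℕ} {m : Fin k → ℕ} {μ : Fin k → Ct}

theorem clsA_eq_zero {u : Ugt n} (hu : u ∈ genSetA n k m μ) : clsA n k m μ u = 0 := by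
  have h : RingQuot.mkAlgHom Ct (fun a b : Ugt n => a - b ∈ genSetA n k m μ) u =
      RingQuot.mkAlgHom Ct (fun a b : Ugt n => a - b ∈ genSetA n k m μ) 0 :=
    RingQuot.mkAlgHom_rel Ct (by
      have h0 : u - 0 = u := sub_zero (G := Ugt n) u
      change u - 0 ∈ genSetA n k m μ
      rwa [h0])
  exact h.trans (map_zero _)

theorem glComm_clsMat : GlComm (X : Ct) (clsMat n k m μ) :=
  (glComm_Egen n).map (RingQuot.mkAlgHom Ct fun a b : Ugt n => a - b ∈ genSetA n k m μ)

theorem opEval_clsMat_prod : opEval (clsMat n k m μ) (∏ j, (X - C (μ j))) = 0 := by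
  ext i j
  exact (map_prodE (RingQuot.mkAlgHom Ct fun a b : Ugt n => a - b ∈ genSetA n k m μ)
    μ i j).symm.trans (clsA_eq_zero (Or.inl ⟨i, j, rfl⟩))

theorem trace_opEval_clsMat {ℓ : ℕ} (hℓ : ℓ ∈ Finset.Icc 1 (k - 1)) :
    (opEval (clsMat n k m μ) (X ^ ℓ : Ct[X])).trace =
      algebraMap Ct (AlgA n k m μ) (theta m μ X ℓ) := by
  let π := RingQuot.mkAlgHom Ct fun a b : Ugt n => a - b ∈ genSetA n k m μ
  have h : π (trE n ℓ - algebraMap Ct (Ugt n) (theta m μ X ℓ)) = 0 :=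
    clsA_eq_zero (Or.inr ⟨ℓ, hℓ, rfl⟩)
  have h2 : π (trE n ℓ) - π (algebraMap Ct (Ugt n) (theta m μ X ℓ)) = 0 :=
    (map_sub π _ _).symm.trans h
  rw [AlgHom.commutes, sub_eq_zero] at h2
  rw [← h2]
  exact (map_trE π ℓ).symm

theorem clsMat_prod_and_trace (hk : 1 ≤ k) (hsum : ∑ i, m i = n) :
    aeval (clsMat n k m μ) (∏ j, (X - C (μ j - (m j : Ct) * X + (n : Ct) * X))) = 0 ∧
    ∀ ℓ, (clsMat n k m μ ^ ℓ).trace = algebraMap Ct (AlgA n k m μ)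
      (theta m (fun j => μ j - (m j : Ct) * X + (n : Ct) * X) (-X) ℓ) :=
  aeval_prod_eq_zero_and_trace_pow m μ X_ne_zero hk (by simpa using hsum) glComm_clsMat
    opEval_clsMat_prod (fun ℓ hℓ => trace_opEval_clsMat hℓ) _ (fun j => by simp)

theorem aeval_neg_prod {R A : Type*} [CommRing R] [Ring A] [Algebra R A] (a : A)
    (ν : Fin k → R) :
    aeval (-a) (∏ j, (X - C (ν j))) = (-1) ^ k * aeval a (∏ j, (X - C (-ν j))) := by
  have h : aeval (-a) (∏ j, (X - C (ν j))) =
      aeval a ((∏ j, (X - C (ν j))).comp (-X)) := by simp [aeval_comp]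
  have h2 : (∏ j, (X - C (ν j))).comp (-X) = (-1) ^ k * ∏ j, (X - C (-ν j)) := by
    rw [Polynomial.prod_comp]
    have h3 : ∀ j, (X - C (ν j)).comp (-X) = -1 * (X - C (-ν j)) := fun j => by
      simp only [sub_comp, X_comp, C_comp, map_neg]
      ring
    simp only [h3, Finset.prod_mul_distrib]
    simp
  rw [h, h2]
  simp

/-- If the spectral data is fixed up to a permutation by the transposed conjugation, every
signed permutation of the negated generators extends to an anti-linear anti-endomorphism. -/
theorem exists_twistOp_hom_algA (hk : 1 ≤ k) (hsum : ∑ i, m i = n) (τ : Equiv.Perm (Fin k))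
    (hτm : ∀ i, m (τ i) = m i)
    (hτμ : ∀ i, -cconj (μ i) = μ (τ i) - (m (τ i) : Ct) * X + (n : Ct) * X)
    (ε : Fin n → ℤ) (hε : ∀ i, ε i * ε i = 1) (σ : Equiv.Perm (Fin n)) :
    ∃ Φ : AlgA n k m μ →ₐ[Ct] TwistOp (AlgA n k m μ), ∀ i j,
      oppositeHom Φ (op (clsA n k m μ (Egen n i j))) =
        -((ε i * ε j) • clsA n k m μ (Egen n (σ i) (σ j))) := by
  obtain ⟨hprod, htr⟩ := clsMat_prod_and_trace (μ := μ) hk hsum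
  obtain ⟨F, hF⟩ := exists_twistOp_hom (glComm_clsMat (m := m) (μ := μ)) ε hε σ
  have hy : (Matrix.of fun a b => oppositeHom F (op (Egen n a b))) =
      signedConj Ct ε hε σ (-clsMat n k m μ) := by
    ext a b
    rw [signedConj_apply, Matrix.of_apply, hF, Matrix.neg_apply, smul_neg]
  have hzero : ∀ u ∈ genSetA n k m μ, oppositeHom F (op u) = 0 := by
    rintro u (⟨i, j, rfl⟩ | ⟨ℓ, -, rfl⟩)
    · rw [oppositeHom_prodE, hy, aeval_algHom_apply, aeval_neg_prod]
      simp only [hτμ]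
      rw [Equiv.prod_comp τ fun j => X - C (μ j - (m j : Ct) * X + (n : Ct) * X), hprod]
      simp
    · have hθ : cconj (theta m μ X ℓ) =
          (-1) ^ ℓ * theta m (fun j => μ j - (m j : Ct) * X + (n : Ct) * X) (-X) ℓ := by
        rw [← conjHom_apply, map_theta, conjHom_X,
          ← theta_comp_perm m (fun j => μ j - (m j : Ct) * X + (n : Ct) * X)
            (neg_ne_zero.2 X_ne_zero) τ hτm]
        have h := theta_neg m (-(conjHom ∘ μ)) (-X : Ct) ℓ
        rw [neg_neg, neg_neg] at h
        rw [h]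
        congr 2
        funext i
        exact hτμ i
      have hs : oppositeHom F (op (trE n ℓ - algebraMap Ct (Ugt n) (theta m μ X ℓ))) =
          oppositeHom F (op (trE n ℓ)) -
            oppositeHom F (op (algebraMap Ct (Ugt n) (theta m μ X ℓ))) :=
        congrArg TwistOp.toBase (map_sub F _ _)
      rw [hs, oppositeHom_trE, oppositeHom_algebraMap, hy, ← map_pow, trace_signedConj, neg_pow,
        hθ, map_mul, ← htr]
      have h1 : ((-1 : Matrix (Fin n) (Fin n) (AlgA n k m μ)) ^ ℓ * clsMat n k m μ ^ ℓ).trace =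
          (-1) ^ ℓ * (clsMat n k m μ ^ ℓ).trace := by
        rcases Nat.even_or_odd ℓ with h | h <;> simp [h.neg_one_pow]
      rw [h1]
      simp
  have hrel : ∀ ⦃a b : Ugt n⦄, a - b ∈ genSetA n k m μ → F a = F b := by
    intro a b hab
    have h : F (a - b) = 0 := unop_injective (α := AlgA n k m μ) (hzero _ hab)
    exact sub_eq_zero.1 ((map_sub F a b).symm.trans h)
  refine ⟨RingQuot.liftAlgHom Ct ⟨F, hrel⟩, fun i j => ?_⟩
  exact (congrArg TwistOp.toBase (RingQuot.liftAlgHom_mkAlgHom_apply Ct F hrel (Egen n i j))).trans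
    (hF i j)

theorem exists_star_algA (hk : 1 ≤ k) (hsum : ∑ i, m i = n) (τ : Equiv.Perm (Fin k))
    (hτm : ∀ i, m (τ i) = m i)
    (hτμ : ∀ i, -cconj (μ i) = μ (τ i) - (m (τ i) : Ct) * X + (n : Ct) * X)
    (ε : Fin n → ℤ) (hε : ∀ i, ε i * ε i = 1) (σ : Equiv.Perm (Fin n))
    (hσ : ∀ i, σ (σ i) = i) (hεσ : ∀ i, ε (σ i) = -ε i) :
    ∃ st : AlgA n k m μ → AlgA n k m μ, IsStarStructure st ∧ ∀ i j,
      st (clsA n k m μ (Egen n i j)) =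
        -((ε i * ε j) • clsA n k m μ (Egen n (σ i) (σ j))) := by
  obtain ⟨Φ, hΦ⟩ := exists_twistOp_hom_algA hk hsum τ hτm hτμ ε hε σ
  have hmul : ∀ u v, oppositeHom Φ (op (u * v)) = oppositeHom Φ (op v) * oppositeHom Φ (op u) :=
    fun u v => by rw [op_mul, map_mul]
  have hadd : ∀ u v, oppositeHom Φ (op (u + v)) = oppositeHom Φ (op u) + oppositeHom Φ (op v) :=
    fun u v => by rw [op_add, map_add]
  have hone : oppositeHom Φ (op 1) = 1 := map_one (oppositeHom Φ)
  let sq : AlgA n k m μ →ₐ[Ct] AlgA n k m μ :=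
    { toFun := fun u => oppositeHom Φ (op (oppositeHom Φ (op u)))
      map_one' := by rw [hone, hone]
      map_mul' := fun u v => by rw [hmul, hmul]
      map_zero' := by rw [op_zero, map_zero, op_zero, map_zero]
      map_add' := fun u v => by rw [hadd, hadd]
      commutes' := fun f => by
        rw [oppositeHom_algebraMap, oppositeHom_algebraMap, ← conjHom_apply, ← conjHom_apply,
          conjHom_conjHom] }
  have hsq : sq = AlgHom.id Ct _ := by
    refine RingQuot.ringQuot_ext' Ct _ _ (RingQuot.ringQuot_ext' Ct _ _
      (FreeAlgebra.hom_ext (funext fun ⟨i, j⟩ => ?_)))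
    change oppositeHom Φ (op (oppositeHom Φ (op (clsA n k m μ (Egen n i j))))) =
      clsA n k m μ (Egen n i j)
    have h : ε i * ε j * (ε i * ε j) = 1 := by
      rw [mul_mul_mul_comm, hε, hε, one_mul]
    rw [hΦ, op_neg, map_neg, op_smul, map_zsmul, hΦ, hσ, hσ, hεσ, hεσ, neg_mul_neg, smul_neg,
      neg_neg, smul_smul, h, one_smul]
  refine ⟨fun u => oppositeHom Φ (op u), ⟨hadd, fun f u => ?_, hmul, hone, fun u => ?_⟩, hΦ⟩
  · change oppositeHom Φ (op (f • u)) = cconj f • oppositeHom Φ (op u)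
    rw [Algebra.smul_def, hmul, oppositeHom_algebraMap, ← Algebra.commutes, ← Algebra.smul_def]
  · exact DFunLike.congr_fun hsq u

end Quotient

section Symplectic

variable {p : ℕ}

/-- The involution `a ↦ a ± p` of `Fin (2 * p)`. -/
def halfSwap (p : ℕ) : Equiv.Perm (Fin (2 * p)) :=
  Function.Involutive.toPerm
    (fun a => if h : (a : ℕ) < p then ⟨a + p, by omega⟩ else ⟨a - p, by omega⟩)
    (fun a => by
      ext
      by_cases h : (a : ℕ) < p
      · simp [h]
      · have h2 : (a : ℕ) - p < p := by omega
        simp [h, h2]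
        omega)

theorem halfSwap_halfSwap (a : Fin (2 * p)) : halfSwap p (halfSwap p a) = a :=
  Function.Involutive.toPerm_involutive _ a

/-- The sign of the only nonzero entry of row `a` of `J`. -/
def halfSign (p : ℕ) (a : Fin (2 * p)) : ℤ := if (a : ℕ) < p then 1 else -1

theorem halfSign_mul_self (a : Fin (2 * p)) : halfSign p a * halfSign p a = 1 := by
  unfold halfSign
  split_ifs <;> rfl

theorem val_halfSwap (a : Fin (2 * p)) :
    (halfSwap p a : ℕ) = if (a : ℕ) < p then (a : ℕ) + p else a - p := by
  change ((if h : (a : ℕ) < p then ⟨a + p, _⟩ else ⟨a - p, _⟩ : Fin (2 * p)) : ℕ) = _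
  split_ifs <;> rfl

theorem halfSign_halfSwap (a : Fin (2 * p)) : halfSign p (halfSwap p a) = -halfSign p a := by
  unfold halfSign
  rw [val_halfSwap]
  split_ifs <;> first | rfl | omega

theorem Jmat_apply (a b : Fin (2 * p)) :
    Jmat (2 * p) p a b = if halfSwap p a = b then (halfSign p a : ℂ) else 0 := by
  simp only [Jmat, Matrix.of_apply, halfSign, Fin.ext_iff, val_halfSwap]
  split_ifs <;> first | (exfalso; omega) | simp

theorem inv_Jmat : (Jmat (2 * p) p)⁻¹ = -Jmat (2 * p) p := by
  refine Matrix.inv_eq_right_inv ?_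
  ext a b
  have h : (halfSign p a : ℂ) * halfSign p a = 1 := by exact_mod_cast halfSign_mul_self a
  simp only [Matrix.mul_apply, Jmat_apply, ite_mul, zero_mul, Finset.sum_ite_eq,
    Finset.mem_univ, if_true, Matrix.neg_apply, halfSwap_halfSwap, halfSign_halfSwap,
    Matrix.one_apply]
  split_ifs <;> simp [h]

theorem Jmat_conj_apply {B : Type*} [Ring B] (f : ℂ →+* B)
    (e : Matrix (Fin (2 * p)) (Fin (2 * p)) B) (i j : Fin (2 * p)) :
    (-((Jmat (2 * p) p).map f * e * ((Jmat (2 * p) p)⁻¹).map f)) i j =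
      -((halfSign p i * halfSign p j) • e (halfSwap p i) (halfSwap p j)) := by
  have h : ∀ b, halfSwap p b = j ↔ b = halfSwap p j := fun b =>
    ⟨fun h => by rw [← h, halfSwap_halfSwap], fun h => by rw [h, halfSwap_halfSwap]⟩
  simp [Matrix.mul_apply, Jmat_apply, inv_Jmat, apply_ite f, h, halfSign_halfSwap, mul_assoc]
  rw [(Int.cast_commute (halfSign p j) _).eq]

end Symplectic

/-- the `u^*(2p)`-compatible real form of the quantum orbit (`n = 2p`). -/
theorem statement13 (n k p : ℕ) (hn2 : n = 2 * p) (hn : 1 ≤ n) (hk : 1 ≤ k) (hkn : k ≤ n)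
    (m : Fin k → ℕ) (hm : ∀ i, 0 < m i) (hsum : ∑ i, m i = n)
    (μ : Fin k → Ct) (τ : Equiv.Perm (Fin k))
    (hτm : ∀ i, m (τ i) = m i)
    (hτμ : ∀ i, -cconj (μ i) = μ (τ i) - (m (τ i) : Ct) * X + (n : Ct) * X) :
    ∃ st : AlgA n k m μ → AlgA n k m μ, IsStarStructure st ∧
      ∀ i j : Fin n,
        st (clsA n k m μ (Egen n i j)) =
          (-((Jmat n p).map (toA n k m μ) *
              Matrix.of (fun a b => clsA n k m μ (Egen n a b)) *
              ((Jmat n p)⁻¹).map (toA n k m μ))) i j := by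
  subst hn2
  obtain ⟨st, hst, h⟩ := exists_star_algA hk hsum τ hτm hτμ (halfSign p) halfSign_mul_self
    (halfSwap p) halfSwap_halfSwap halfSign_halfSwap
  exact ⟨st, hst, fun i j => by rw [h, Jmat_conj_apply, Matrix.of_apply]⟩

end
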